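/- Let P be a pree satisfying Axioms A(4) and A(5), and let a, b, c ∈ P. Then π(a)π(b) = π(c) holds in the universal group U(P) if and only if the product ab is defined in P and ab = c. In other words, the multiplication in P is induced by the multiplication in U(P). -/

import Mathlib

/-- A pree: a set with identity, involutive inverse, and a partial multiplication
(represented as an `Option`-valued multiplication) satisfying the pree axioms. -/
structure Pree (α : Type*) where
  one : α
  inv : α → α
  mul : α → α → Option α
  one_mul' : ∀ a, mul one a = some a
  mul_one' : ∀ a, mul a one = some a
  inv_inv' : ∀ a, inv (inv a) = a
  mul_inv' : ∀ a, mul a (inv a) = some one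
  inv_mul' : ∀ a, mul (inv a) a = some one
  assoc_defined : ∀ {a b c x y : α}, mul a b = some x → mul b c = some y →
    ((mul x c).isSome ↔ (mul a y).isSome)
  assoc_eq : ∀ {a b c x y z : α}, mul a b = some x → mul b c = some y →
    mul x c = some z → mul a y = some z

namespace Pree

variable {α : Type*} (P : Pree α)

/-- The relators `a b c⁻¹` for every product `ab = c` defined in `P`. -/
def rels : Set (FreeGroup α) :=
  {r | ∃ a b c : α, P.mul a b = some c ∧
    r = FreeGroup.of a * FreeGroup.of b * (FreeGroup.of c)⁻¹}

/-- The universal group `U(P)` of a pree `P`. -/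
abbrev UniversalGroup := PresentedGroup P.rels

/-- The canonical map `π : P → U(P)`. -/
def pi (a : α) : P.UniversalGroup := PresentedGroup.of a

/-- Axiom A(4). -/
def A4 : Prop := ∀ a₁ a₂ a₃ a₄ b₁ b₂ b₃ b₄ : α,
  P.mul (P.inv a₁) a₂ = some b₁ → P.mul (P.inv a₂) a₃ = some b₂ →
  P.mul (P.inv a₃) a₄ = some b₃ → P.mul (P.inv a₄) a₁ = some b₄ →
  (P.mul b₁ b₂).isSome ∨ (P.mul b₂ b₃).isSome ∨ (P.mul b₃ b₄).isSome ∨ (P.mul b₄ b₁).isSome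

/-- Axiom A(5). -/
def A5 : Prop := ∀ a₁ a₂ a₃ a₄ a₅ b₁ b₂ b₃ b₄ b₅ : α,
  P.mul (P.inv a₁) a₂ = some b₁ → P.mul (P.inv a₂) a₃ = some b₂ →
  P.mul (P.inv a₃) a₄ = some b₃ → P.mul (P.inv a₄) a₅ = some b₄ →
  P.mul (P.inv a₅) a₁ = some b₅ →
  (P.mul b₁ b₂).isSome ∨ (P.mul b₂ b₃).isSome ∨ (P.mul b₃ b₄).isSome ∨
    (P.mul b₄ b₅).isSome ∨ (P.mul b₅ b₁).isSome

/-- A word over `P` is reducible if the product of two successive letters is defined. -/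
def Reducible (w : List α) : Prop :=
  ∃ (u : List α) (a b : α) (v : List α), w = u ++ a :: b :: v ∧ (P.mul a b).isSome

/-- The element of `U(P)` represented by a word over `P`. -/
def wordProd (w : List α) : P.UniversalGroup := (w.map P.pi).prod

end Pree

namespace Pree

universe u

variable {α : Type u} {P : Pree α}

section Algebra

theorem mul_assoc_iff {a b c x y z : α} (hx : P.mul a b = some x) (hy : P.mul b c = some y) :
    P.mul x c = some z ↔ P.mul a y = some z := by
  refine ⟨P.assoc_eq hx hy, fun h => ?_⟩
  obtain ⟨z', hz'⟩ := Option.isSome_iff_exists.1 ((P.assoc_defined hx hy).2 (by simp [h]))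
  have := P.assoc_eq hx hy hz'
  simp_all

theorem inv_mul_of_mul {a b c : α} (h : P.mul a b = some c) : P.mul (P.inv a) c = some b :=
  (mul_assoc_iff (P.inv_mul' a) h).1 (P.one_mul' b)

theorem mul_inv_of_mul {a b c : α} (h : P.mul a b = some c) : P.mul c (P.inv b) = some a :=
  (mul_assoc_iff h (P.mul_inv' b)).2 (P.mul_one' a)

theorem inv_mul_inv_of_mul {a b c : α} (h : P.mul a b = some c) :
    P.mul (P.inv b) (P.inv a) = some (P.inv c) :=
  inv_mul_of_mul (mul_inv_of_mul (inv_mul_of_mul h))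

theorem eq_inv_of_mul_eq_one {a b : α} (h : P.mul a b = some P.one) : a = P.inv b := by
  simpa [P.one_mul'] using (mul_inv_of_mul h).symm

/-- Adjacency in the link of a vertex: `a` and `b` span a triangle with the vertex. -/
def Adj (P : Pree α) (a b : α) : Prop := ∃ c, P.mul (P.inv a) b = some c

theorem Adj.symm {a b : α} (h : P.Adj a b) : P.Adj b a := by
  obtain ⟨c, hc⟩ := h
  exact ⟨P.inv c, by simpa [P.inv_inv'] using inv_mul_inv_of_mul hc⟩

theorem adj_of_mul {a b c x y : α} (hx : P.mul (P.inv a) b = some x)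
    (hy : P.mul (P.inv b) c = some y) (h : (P.mul x y).isSome) : P.Adj a c := by
  have hb := inv_mul_of_mul hy
  rw [P.inv_inv'] at hb
  exact Option.isSome_iff_exists.1 ((P.assoc_defined hx hb).1 h)

/-- Axiom A(4) says that squares in links have a diagonal. -/
theorem A4.adj (h4 : P.A4) {a b c d : α} (hab : P.Adj a b) (hbc : P.Adj b c) (hcd : P.Adj c d)
    (hda : P.Adj d a) : P.Adj a c ∨ P.Adj b d := by
  obtain ⟨_, h₁⟩ := hab
  obtain ⟨_, h₂⟩ := hbc
  obtain ⟨_, h₃⟩ := hcd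
  obtain ⟨_, h₄⟩ := hda
  rcases h4 _ _ _ _ _ _ _ _ h₁ h₂ h₃ h₄ with h | h | h | h
  · exact .inl (adj_of_mul h₁ h₂ h)
  · exact .inr (adj_of_mul h₂ h₃ h)
  · exact .inl (adj_of_mul h₃ h₄ h).symm
  · exact .inr (adj_of_mul h₄ h₁ h).symm

/-- Axioms A(4) and A(5) say that a pentagon in a link is a union of triangles; in particular
a vertex `e` off the diagonals is cut off by the opposite diagonal. -/
theorem adj_of_pentagon (h4 : P.A4) (h5 : P.A5) {a b c d e : α} (hab : P.Adj a b)
    (hbc : P.Adj b c) (hcd : P.Adj c d) (hde : P.Adj d e) (hea : P.Adj e a)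
    (heb : ¬ P.Adj e b) (hec : ¬ P.Adj e c) : P.Adj a d := by
  obtain ⟨_, h₁⟩ := id hab
  obtain ⟨_, h₂⟩ := id hbc
  obtain ⟨_, h₃⟩ := id hcd
  obtain ⟨_, h₄⟩ := id hde
  obtain ⟨_, h₅⟩ := id hea
  rcases h5 _ _ _ _ _ _ _ _ _ _ h₁ h₂ h₃ h₄ h₅ with h | h | h | h | h
  · have hac := adj_of_mul h₁ h₂ h
    exact (h4.adj hac hcd hde hea).resolve_right fun k => hec k.symm
  · have hbd := adj_of_mul h₂ h₃ h
    exact (h4.adj hab hbd hde hea).resolve_right fun k => heb k.symm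
  · exact absurd (adj_of_mul h₃ h₄ h).symm hec
  · exact (adj_of_mul h₄ h₅ h).symm
  · exact absurd (adj_of_mul h₅ h₁ h) heb

end Algebra

/-- A ball in the Cayley complex to be constructed: `Edge x a y` means `y = x a`, and
every vertex off the boundary `Sphere` has all its edges. -/
structure Ball (P : Pree α) where
  Vertex : Type u
  Edge : Vertex → α → Vertex → Prop
  Sphere : Vertex → Prop
  edge_unique : ∀ {x a y z}, Edge x a y → Edge x a z → y = z
  edge_one : ∀ x, Edge x P.one x
  edge_inv : ∀ {x a y}, Edge x a y → Edge y (P.inv a) x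
  edge_mul : ∀ {x a y b z c}, Edge x a y → Edge y b z → P.mul a b = some c → Edge x c z
  exists_edge : ∀ {x}, ¬ Sphere x → ∀ a, ∃ y, Edge x a y
  /-- The interior neighbours of a boundary vertex form a clique. -/
  adj_of_interior : ∀ {x a y b z}, Sphere x → Edge x a y → Edge x b z → ¬ Sphere y →
    ¬ Sphere z → P.Adj a b
  /-- Every boundary edge lies in a triangle whose third vertex is interior. -/
  exists_triangle : ∀ {x a y}, Sphere x → Sphere y → Edge x a y →
    ∃ b z, ¬ Sphere z ∧ Edge x b z ∧ P.Adj a b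

namespace Ball

/-- All words of length at most `n` can be read along edges starting at the given vertex. -/
def Deep (B : P.Ball) : ℕ → B.Vertex → Prop
  | 0, _ => True
  | n + 1, x => ∀ a, ∃ y, B.Edge x a y ∧ B.Deep n y

/-- `B.Path x w y` says that reading `w` along edges from `x` leads to `y`. -/
def Path (B : P.Ball) : B.Vertex → List α → B.Vertex → Prop
  | x, [], y => x = y
  | x, a :: w, y => ∃ z, B.Edge x a z ∧ B.Path z w y

/-- The ball of radius one. -/
def unit (P : Pree α) : P.Ball where
  Vertex := α
  Edge x a y := P.mul x a = some y
  Sphere x := x ≠ P.one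
  edge_unique h h' := by simp_all
  edge_one := P.mul_one'
  edge_inv h := mul_inv_of_mul h
  edge_mul h h' hc := (mul_assoc_iff h hc).1 h'
  exists_edge {x} hx a := ⟨a, by rw [not_not.1 hx]; exact P.one_mul' a⟩
  adj_of_interior {x a y b z} _ ha hb hy hz := by
    rw [not_not.1 hy] at ha
    rw [not_not.1 hz] at hb
    have ha' := inv_mul_of_mul ha
    have hb' := inv_mul_of_mul hb
    obtain rfl : a = b := by simp_all
    exact ⟨_, P.inv_mul' a⟩
  exists_triangle {x a y} _ _ h :=
    ⟨P.inv x, P.one, not_not.2 rfl, P.mul_inv' x, _, inv_mul_inv_of_mul h⟩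

section Extension

variable (B : P.Ball)

/-- Edges which are missing in the ball. -/
abbrev Missing : Type u := {p : B.Vertex × α // ∀ y, ¬ B.Edge p.1 p.2 y}

variable {B}

/-- Two missing edges have the same endpoint if they are sides of a triangle whose third side
lies in the ball. -/
def Missing.Rel (p q : B.Missing) : Prop :=
  ∃ c, B.Edge p.1.1 c q.1.1 ∧ P.mul c q.1.2 = some p.1.2

theorem Missing.sphere (p : B.Missing) : B.Sphere p.1.1 := by
  by_contra h
  obtain ⟨y, hy⟩ := B.exists_edge h p.1.2
  exact p.2 y hy

theorem Missing.Rel.refl (p : B.Missing) : p.Rel p :=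
  ⟨P.one, B.edge_one _, P.one_mul' _⟩

theorem Missing.Rel.symm {p q : B.Missing} : p.Rel q → q.Rel p := by
  rintro ⟨c, hc, h⟩
  exact ⟨P.inv c, B.edge_inv hc, inv_mul_of_mul h⟩

theorem Missing.not_adj (p : B.Missing) {a : α} {y : B.Vertex} (h : B.Edge p.1.1 a y)
    (hy : ¬ B.Sphere y) : ¬ P.Adj p.1.2 a := by
  intro hadj
  obtain ⟨c, hc⟩ := hadj.symm
  obtain ⟨z, hz⟩ := B.exists_edge hy c
  have := inv_mul_of_mul hc
  rw [P.inv_inv'] at this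
  exact p.2 z (B.edge_mul h hz this)

theorem Missing.Rel.trans (h4 : P.A4) (h5 : P.A5) {p q r : B.Missing} :
    p.Rel q → q.Rel r → p.Rel r := by
  rintro ⟨c, hc, hcm⟩ ⟨e, he, hem⟩
  obtain ⟨s, y, hy, hs, hcs⟩ := B.exists_triangle q.sphere p.sphere (B.edge_inv hc)
  obtain ⟨t, z, hz, ht, het⟩ := B.exists_triangle q.sphere r.sphere he
  have hst := B.adj_of_interior q.sphere hs ht hy hz
  have hce : P.Adj (P.inv c) e :=
    adj_of_pentagon h4 h5 hcs hst het.symm ⟨_, inv_mul_of_mul hem⟩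
      (Adj.symm ⟨_, by rw [P.inv_inv']; exact hcm⟩) (q.not_adj hs hy) (q.not_adj ht hz)
  obtain ⟨f, hf⟩ := hce
  rw [P.inv_inv'] at hf
  exact ⟨f, B.edge_mul hc he hf, (mul_assoc_iff hf hem).2 hcm⟩

/-- Identification of missing edges with the same endpoint. -/
def missingSetoid (B : P.Ball) (h4 : P.A4) (h5 : P.A5) : Setoid B.Missing where
  r := Missing.Rel
  iseqv := ⟨Missing.Rel.refl, Missing.Rel.symm, Missing.Rel.trans h4 h5⟩

variable (B) (h4 : P.A4) (h5 : P.A5)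

/-- The vertices of the next sphere. -/
abbrev NewVertex : Type u := Quotient (B.missingSetoid h4 h5)

variable {B h4 h5}

/-- The missing edge at `x` labelled `a` ends at the new vertex `v`. -/
def Out (x : B.Vertex) (a : α) (v : B.NewVertex h4 h5) : Prop :=
  ∃ h : ∀ y, ¬ B.Edge x a y, Quotient.mk _ ⟨(x, a), h⟩ = v

theorem exists_out (v : B.NewVertex h4 h5) : ∃ x a, Out x a v := by
  induction v using Quotient.inductionOn with
  | h p => exact ⟨p.1.1, p.1.2, p.2, rfl⟩

theorem Out.unique {x : B.Vertex} {a : α} {v w : B.NewVertex h4 h5} :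
    Out x a v → Out x a w → v = w := by
  rintro ⟨_, rfl⟩ ⟨_, rfl⟩
  rfl

theorem Out.connect {x y : B.Vertex} {a b : α} {v : B.NewVertex h4 h5} :
    Out x a v → Out y b v → ∃ c, B.Edge x c y ∧ P.mul c b = some a := by
  rintro ⟨h, rfl⟩ ⟨h', e⟩
  exact Missing.Rel.symm (Quotient.exact e)

theorem Out.transport {x y : B.Vertex} {a b c : α} {v : B.NewVertex h4 h5} :
    Out y b v → B.Edge x c y → P.mul c b = some a → Out x a v := by
  rintro ⟨h, rfl⟩ hc hm
  refine ⟨fun z hz => h z (B.edge_mul (B.edge_inv hc) hz (inv_mul_of_mul hm)), ?_⟩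
  exact Quotient.sound ⟨c, hc, hm⟩

/-- The edges of the extended ball. -/
def ExtEdge : B.Vertex ⊕ B.NewVertex h4 h5 → α → B.Vertex ⊕ B.NewVertex h4 h5 → Prop
  | .inl x, a, .inl y => B.Edge x a y
  | .inl x, a, .inr v => Out x a v
  | .inr v, a, .inl x => Out x (P.inv a) v
  | .inr v, a, .inr w => ∃ x b c, Out x b v ∧ Out x c w ∧ P.mul b a = some c

theorem ExtEdge.inv {x y : B.Vertex ⊕ B.NewVertex h4 h5} {a : α} (h : ExtEdge x a y) :
    ExtEdge y (P.inv a) x := by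
  rcases x with x | v <;> rcases y with y | w
  · exact B.edge_inv h
  · simpa [ExtEdge, P.inv_inv'] using h
  · exact h
  · obtain ⟨x, b, c, hb, hc, hm⟩ := h
    exact ⟨x, c, b, hc, hb, mul_inv_of_mul hm⟩

theorem ExtEdge.unique {x y z : B.Vertex ⊕ B.NewVertex h4 h5} {a : α} (h : ExtEdge x a y)
    (h' : ExtEdge x a z) : y = z := by
  have mixed {v w : B.NewVertex h4 h5} {y : B.Vertex} (h : ExtEdge (.inr v) a (.inl y))
      (h' : ExtEdge (.inr v) a (.inr w)) : False := by
    obtain ⟨x, b, c, hb, ⟨hc, _⟩, hm⟩ := h'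
    obtain ⟨e, he, hem⟩ := Out.connect h hb
    have hec := eq_inv_of_mul_eq_one ((mul_assoc_iff hem hm).1 (P.inv_mul' a))
    have := B.edge_inv he
    rw [hec, P.inv_inv'] at this
    exact hc _ this
  rcases x with x | v <;> rcases y with y | w <;> rcases z with z | w'
  · exact congrArg _ (B.edge_unique h h')
  · exact absurd h (h'.1 y)
  · exact absurd h' (h.1 z)
  · exact congrArg _ (Out.unique h h')
  · obtain ⟨c, hc, hm⟩ := Out.connect h h'
    have := mul_inv_of_mul hm
    rw [P.mul_inv'] at this
    rw [← Option.some.inj this] at hc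
    exact congrArg _ (B.edge_unique (B.edge_one y) hc)
  · exact (mixed h h').elim
  · exact (mixed h' h).elim
  · obtain ⟨x, b, c, hb, hc, hm⟩ := h
    obtain ⟨y, b', c', hb', hc', hm'⟩ := h'
    obtain ⟨e, he, hem⟩ := hb.connect hb'
    exact congrArg _ (hc.unique (hc'.transport he ((mul_assoc_iff hem hm').1 hm)))

theorem ExtEdge.mul {x y z : B.Vertex ⊕ B.NewVertex h4 h5} {a b c : α} (h : ExtEdge x a y)
    (h' : ExtEdge y b z) (hm : P.mul a b = some c) : ExtEdge x c z := by
  have fromOld {x : B.Vertex} {y z : B.Vertex ⊕ B.NewVertex h4 h5} {a b c : α}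
      (h : ExtEdge (.inl x) a y) (h' : ExtEdge y b z) (hm : P.mul a b = some c) :
      ExtEdge (.inl x) c z := by
    rcases y with y | v <;> rcases z with z | w
    · exact B.edge_mul h h' hm
    · exact Out.transport h' h hm
    · obtain ⟨e, he, hem⟩ := Out.connect h h'
      have := mul_inv_of_mul hem
      rw [P.inv_inv', hm] at this
      rwa [← Option.some.inj this] at he
    · obtain ⟨y, p, q, hp, hq, hpq⟩ := h'
      obtain ⟨e, he, hem⟩ := Out.connect h hp
      exact hq.transport he ((mul_assoc_iff hem hpq).1 hm)
  rcases x with x | u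
  · exact fromOld h h' hm
  rcases z with z | w
  · have := (fromOld h'.inv h.inv (inv_mul_inv_of_mul hm)).inv
    rwa [P.inv_inv'] at this
  rcases y with y | v
  · exact ⟨y, P.inv a, b, h, h', inv_mul_of_mul hm⟩
  obtain ⟨x, p, q, hp, hq, hpq⟩ := h
  obtain ⟨y, r, s, hr, hs, hrs⟩ := h'
  obtain ⟨e, he, hem⟩ := hq.connect hr
  have hux : P.Adj (P.inv a) (P.inv q) := ⟨_, inv_mul_of_mul (inv_mul_inv_of_mul hpq)⟩
  have hxy : P.Adj (P.inv q) (P.inv r) :=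
    ⟨e, by rw [P.inv_inv']; exact mul_inv_of_mul hem⟩
  have hyw : P.Adj (P.inv r) b := ⟨s, by rwa [P.inv_inv']⟩
  have hwu : P.Adj b (P.inv a) := ⟨_, inv_mul_inv_of_mul hm⟩
  rcases h4.adj hux hxy hyw hwu with hd | hd
  · obtain ⟨f, hf⟩ := hd.symm
    rw [P.inv_inv'] at hf
    exact ⟨y, f, s, hp.transport (B.edge_inv he)
      ((mul_assoc_iff (inv_mul_of_mul hem) (mul_inv_of_mul hpq)).1 hf), hs,
      (mul_assoc_iff hf (inv_mul_of_mul hm)).2 hrs⟩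
  · obtain ⟨f, hf⟩ := hd
    rw [P.inv_inv'] at hf
    exact ⟨x, p, f, hp, hs.transport he ((mul_assoc_iff hem hrs).1 hf),
      (mul_assoc_iff hpq hm).1 hf⟩

variable (B h4 h5) in
/-- The ball of the next larger radius. -/
def extend : P.Ball where
  Vertex := B.Vertex ⊕ B.NewVertex h4 h5
  Edge := ExtEdge
  Sphere x := x.isRight
  edge_unique := ExtEdge.unique
  edge_one x := by
    rcases x with x | v
    · exact B.edge_one x
    · obtain ⟨x, a, h⟩ := exists_out v
      exact ⟨x, a, a, h, h, P.mul_one' a⟩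
  edge_inv := ExtEdge.inv
  edge_mul := ExtEdge.mul
  exists_edge {x} hx a := by
    rcases x with x | v
    · by_cases h : ∃ y, B.Edge x a y
      · obtain ⟨y, hy⟩ := h
        exact ⟨.inl y, hy⟩
      · exact ⟨.inr _, not_exists.1 h, rfl⟩
    · simp at hx
  adj_of_interior {x a y b z} hx ha hb hy hz := by
    rcases x with x | v
    · simp at hx
    rcases y with y | _
    · rcases z with z | _
      · obtain ⟨e, -, hm⟩ := Out.connect ha hb
        have := mul_inv_of_mul hm
        rw [P.inv_inv'] at this
        exact ⟨e, this⟩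
      · simp at hz
    · simp at hy
  exists_triangle {x a y} hx hy h := by
    rcases x with x | v
    · simp at hx
    rcases y with y | w
    · simp at hy
    obtain ⟨z, p, q, hp, -, hm⟩ := h
    exact ⟨P.inv p, .inl z, by simp, by simpa [ExtEdge, P.inv_inv'] using hp, _,
      inv_mul_inv_of_mul hm⟩

theorem Deep.extend {n : ℕ} {x : B.Vertex} (h : B.Deep n x) :
    (B.extend h4 h5).Deep (n + 1) (.inl x) := by
  induction n generalizing x with
  | zero =>
    intro a
    obtain ⟨y, hy⟩ := (B.extend h4 h5).exists_edge (x := .inl x) (by simp [Ball.extend]) a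
    exact ⟨y, hy, trivial⟩
  | succ n ih =>
    intro a
    obtain ⟨y, hy, hd⟩ := h a
    exact ⟨.inl y, hy, ih hd⟩

end Extension

/-- `P` embeds into balls of arbitrarily large radius. -/
theorem exists_deep (h4 : P.A4) (h5 : P.A5) (n : ℕ) :
    ∃ (B : P.Ball) (ι : α → B.Vertex),
      (∀ x a y, B.Edge (ι x) a (ι y) ↔ P.mul x a = some y) ∧ B.Deep n (ι P.one) := by
  induction n with
  | zero => exact ⟨unit P, id, fun _ _ _ => Iff.rfl, trivial⟩
  | succ n ih =>
    obtain ⟨B, ι, hι, hd⟩ := ih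
    exact ⟨B.extend h4 h5, fun x => .inl (ι x), hι, hd.extend⟩

variable {B : P.Ball}

theorem Deep.mono {m n : ℕ} (hmn : m ≤ n) {x : B.Vertex} (h : B.Deep n x) : B.Deep m x := by
  induction m generalizing n x with
  | zero => trivial
  | succ m ih =>
    obtain ⟨n, rfl⟩ : ∃ k, n = k + 1 := ⟨n - 1, by omega⟩
    intro a
    obtain ⟨y, hy, hd⟩ := h a
    exact ⟨y, hy, ih (by omega) hd⟩

theorem path_append {x y : B.Vertex} {v w : List α} :
    B.Path x (v ++ w) y ↔ ∃ z, B.Path x v z ∧ B.Path z w y := by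
  induction v generalizing x with
  | nil => simp [Path]
  | cons a v ih =>
    simp only [List.cons_append, Path, ih]
    exact ⟨fun ⟨s, hs, t, ht, h⟩ => ⟨t, ⟨s, hs, ht⟩, h⟩,
      fun ⟨t, ⟨s, hs, ht⟩, h⟩ => ⟨s, hs, t, ht, h⟩⟩

theorem Deep.of_path {n : ℕ} {x y : B.Vertex} {w : List α} (h : B.Deep (w.length + n) x)
    (hw : B.Path x w y) : B.Deep n y := by
  induction w generalizing x with
  | nil =>
    obtain rfl : x = y := hw
    simpa using h
  | cons a w ih =>
    obtain ⟨z, hz, hzy⟩ := hw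
    rw [List.length_cons, add_right_comm] at h
    obtain ⟨z', hz', hd⟩ := h a
    rw [← B.edge_unique hz hz'] at hd
    exact ih hd hzy

end Ball

section Words

/-- The defining relations of the universal group, as relations between positive words. -/
inductive WordRel (P : Pree α) : FreeMonoid α → FreeMonoid α → Prop
  | one : WordRel P 1 (.of P.one)
  | mul {a b c : α} : P.mul a b = some c → WordRel P (.of a * .of b) (.of c)

/-- The class of a letter, as a unit in the monoid of words modulo the defining relations. -/
def letterUnit (P : Pree α) (a : α) : ((conGen P.WordRel).Quotient)ˣ where
  val := (FreeMonoid.of a : FreeMonoid α)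
  inv := (FreeMonoid.of (P.inv a) : FreeMonoid α)
  val_inv := ((conGen P.WordRel).eq).2
    ((conGen P.WordRel).trans (.of _ _ (.mul (P.mul_inv' a))) (.symm (.of _ _ .one)))
  inv_val := ((conGen P.WordRel).eq).2
    ((conGen P.WordRel).trans (.of _ _ (.mul (P.inv_mul' a))) (.symm (.of _ _ .one)))

theorem letterUnit_mul {a b c : α} (h : P.mul a b = some c) :
    P.letterUnit a * P.letterUnit b = P.letterUnit c :=
  Units.ext (((conGen P.WordRel).eq).2 (.of _ _ (.mul h)))

theorem conGen_of_pi_mul {a b c : α} (h : P.pi a * P.pi b = P.pi c) :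
    conGen P.WordRel (.of a * .of b) (.of c) := by
  have hrels : ∀ r ∈ P.rels, FreeGroup.lift P.letterUnit r = 1 := by
    rintro _ ⟨a, b, c, h, rfl⟩
    simp [letterUnit_mul h]
  have := congrArg (PresentedGroup.toGroup hrels) h
  simp only [pi, map_mul, PresentedGroup.toGroup.of] at this
  exact ((conGen P.WordRel).eq).1 (congrArg Units.val this)

theorem exists_path_iff {v w : FreeMonoid α} (h : conGen P.WordRel v w) :
    ∃ n, ∀ (B : P.Ball) (x : B.Vertex), B.Deep n x →
      ∀ y, B.Path x v.toList y ↔ B.Path x w.toList y := by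
  replace h : ConGen.Rel P.WordRel v w := h
  induction h with
  | of v w h =>
    refine ⟨2, fun B x hx y => ?_⟩
    cases h with
    | one =>
      refine ⟨?_, ?_⟩
      · rintro rfl
        exact ⟨x, B.edge_one x, rfl⟩
      · rintro ⟨_, h, rfl⟩
        exact B.edge_unique (B.edge_one x) h
    | mul h =>
      refine ⟨?_, ?_⟩
      · rintro ⟨z, hz, _, hy, rfl⟩
        exact ⟨_, B.edge_mul hz hy h, rfl⟩
      · rintro ⟨_, hc, rfl⟩
        obtain ⟨z, hz, hd⟩ := hx _
        obtain ⟨y', hy', -⟩ := hd _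
        exact ⟨z, hz, y', hy', B.edge_unique (B.edge_mul hz hy' h) hc⟩
  | refl v => exact ⟨0, fun _ _ _ _ => Iff.rfl⟩
  | symm _ ih =>
    obtain ⟨n, hn⟩ := ih
    exact ⟨n, fun B x hx y => (hn B x hx y).symm⟩
  | trans _ _ ih ih' =>
    obtain ⟨m, hm⟩ := ih
    obtain ⟨n, hn⟩ := ih'
    exact ⟨max m n, fun B x hx y => (hm B x (hx.mono (le_max_left ..)) y).trans
      (hn B x (hx.mono (le_max_right ..)) y)⟩
  | @mul v v' w w' _ _ ih ih' =>
    obtain ⟨m, hm⟩ := ih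
    obtain ⟨n, hn⟩ := ih'
    refine ⟨max m (v.toList.length + n), fun B x hx y => ?_⟩
    rw [FreeMonoid.toList_mul, FreeMonoid.toList_mul, Ball.path_append, Ball.path_append]
    refine exists_congr fun z => ?_
    rw [← hm B x (hx.mono (le_max_left ..)) z]
    exact and_congr_right fun hz => hn B z ((hx.mono (le_max_right ..)).of_path hz) y

end Words

theorem pi_mul_of_mul {a b c : α} (h : P.mul a b = some c) : P.pi a * P.pi b = P.pi c :=
  mul_inv_eq_one.1 (PresentedGroup.one_of_mem (rels := P.rels) ⟨a, b, c, h, rfl⟩)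

end Pree

/-- If a pree `P` satisfies Axioms A(4) and A(5), then for all `a b c ∈ P`,
`π(a)π(b) = π(c)` in `U(P)` iff the product `ab` is defined in `P` and equals `c`. -/
theorem pree_mul_induced_by_universal_group {α : Type*} (P : Pree α)
    (h4 : P.A4) (h5 : P.A5) (a b c : α) :
    P.pi a * P.pi b = P.pi c ↔ P.mul a b = some c := by
  refine ⟨fun h => ?_, Pree.pi_mul_of_mul⟩
  obtain ⟨n, hn⟩ := Pree.exists_path_iff (Pree.conGen_of_pi_mul h)
  obtain ⟨B, ι, hι, hd⟩ := Pree.Ball.exists_deep h4 h5 n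
  obtain ⟨y, hy, _, hz, rfl⟩ :=
    (hn B _ hd (ι c)).2 ⟨ι c, (hι _ _ _).2 (P.one_mul' c), rfl⟩
  rw [← B.edge_unique ((hι _ _ _).2 (P.one_mul' a)) hy] at hz
  exact (hι _ _ _).1 hz
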